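/- Let H be a non-empty graph. If the vertex of K_1 belongs to some local metric basis of the join K_1 + H, then for any connected graph G of order n ≥ 2, dim_l(G ⊙ H) = n·(dim_l(K_1 + H) − 1). -/

import Mathlib

open SimpleGraph

/-- A set `S` is a local metric generator for `G` if every pair of adjacent
vertices is distinguished, by distance, by some element of `S`. -/
def IsLocalMetricGenerator {V : Type*} (G : SimpleGraph V) (S : Set V) : Prop :=
  ∀ ⦃u v : V⦄, G.Adj u v → ∃ w ∈ S, G.dist u w ≠ G.dist v w

/-- The local metric dimension of a graph. -/
noncomputable def localMetricDim {V : Type*} [Fintype V] (G : SimpleGraph V) : ℕ :=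
  sInf {k | ∃ S : Finset V, IsLocalMetricGenerator G ↑S ∧ S.card = k}

/-- A local metric basis: a local metric generator of minimum cardinality. -/
def IsLocalMetricBasis {V : Type*} [Fintype V] (G : SimpleGraph V) (S : Finset V) : Prop :=
  IsLocalMetricGenerator G ↑S ∧ S.card = localMetricDim G

/-- The join K₁ + H: a new vertex (`none`) adjacent to all vertices of H. -/
def oneJoin {W : Type*} (H : SimpleGraph W) : SimpleGraph (Option W) :=
  SimpleGraph.fromRel (fun a b => match a, b with
    | none, some _ => True
    | some x, some y => H.Adj x y
    | _, _ => False)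

/-- The corona product G ⊙ H: one copy of G and a copy of H for each vertex
i of G, with i joined to every vertex of its copy of H. -/
def corona {V W : Type*} (G : SimpleGraph V) (H : SimpleGraph W) :
    SimpleGraph (V ⊕ V × W) :=
  SimpleGraph.fromRel (fun a b => match a, b with
    | .inl u, .inl w => G.Adj u w
    | .inr p, .inr q => p.1 = q.1 ∧ H.Adj p.2 q.2
    | .inl u, .inr p => u = p.1
    | .inr _, .inl _ => False)

section CoronaHelpers

variable {V W : Type*} {G : SimpleGraph V} {H : SimpleGraph W}

lemma oneJoin_none_some (x : W) : (oneJoin H).Adj none (some x) := by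
  simp [oneJoin]

lemma oneJoin_some_some (x y : W) : (oneJoin H).Adj (some x) (some y) ↔ H.Adj x y := by
  simp only [oneJoin, SimpleGraph.fromRel_adj, ne_eq, Option.some.injEq]
  constructor
  · rintro ⟨_, h | h⟩
    · exact h
    · exact h.symm
  · intro h
    exact ⟨h.ne, Or.inl h⟩

lemma corona_ll (u v : V) : (corona G H).Adj (.inl u) (.inl v) ↔ G.Adj u v := by
  simp only [corona, SimpleGraph.fromRel_adj, ne_eq, Sum.inl.injEq]
  constructor
  · rintro ⟨_, h | h⟩
    · exact h
    · exact h.symm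
  · intro h
    exact ⟨h.ne, Or.inl h⟩

lemma corona_lr (u : V) (p : V × W) : (corona G H).Adj (.inl u) (.inr p) ↔ u = p.1 := by
  simp [corona]

lemma corona_rl (u : V) (p : V × W) : (corona G H).Adj (.inr p) (.inl u) ↔ u = p.1 := by
  rw [SimpleGraph.adj_comm, corona_lr]

lemma corona_rr (p q : V × W) :
    (corona G H).Adj (.inr p) (.inr q) ↔ p.1 = q.1 ∧ H.Adj p.2 q.2 := by
  simp only [corona, SimpleGraph.fromRel_adj, ne_eq, Sum.inr.injEq]
  constructor
  · rintro ⟨_, h | h⟩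
    · exact h
    · exact ⟨h.1.symm, h.2.symm⟩
  · intro h
    refine ⟨?_, Or.inl h⟩
    rintro rfl
    exact h.2.ne rfl

lemma dist_two_of_common {U : Type*} {K : SimpleGraph U} {a b c : U} (hab : a ≠ b)
    (hn : ¬ K.Adj a b) (h1 : K.Adj a c) (h2 : K.Adj c b) : K.dist a b = 2 := by
  have hr : K.Reachable a b := h1.reachable.trans h2.reachable
  have hle : K.dist a b ≤ 2 := by
    simpa using K.dist_le (Walk.cons h1 (Walk.cons h2 Walk.nil))
  have h0 : K.dist a b ≠ 0 := fun h => hab (hr.dist_eq_zero_iff.1 h)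
  have h1 : K.dist a b ≠ 1 := fun h => hn (SimpleGraph.dist_eq_one_iff_adj.1 h)
  omega

lemma dist_copy (i : V) (x z : W) :
    (corona G H).dist (.inr (i, x)) (.inr (i, z)) = (oneJoin H).dist (some x) (some z) := by
  by_cases hxz : x = z
  · subst hxz; simp
  by_cases ha : H.Adj x z
  · rw [SimpleGraph.dist_eq_one_iff_adj.2 ((corona_rr (i, x) (i, z)).2 ⟨rfl, ha⟩),
      SimpleGraph.dist_eq_one_iff_adj.2 ((oneJoin_some_some _ _).2 ha)]
  · rw [dist_two_of_common (c := Sum.inl i) (by simpa using hxz)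
      (fun h => ha ((corona_rr _ _).1 h).2) ((corona_rl _ _).2 rfl) ((corona_lr _ _).2 rfl),
      dist_two_of_common (c := none) (by simpa using hxz)
      (fun h => ha ((oneJoin_some_some _ _).1 h)) (oneJoin_none_some _).symm
      (oneJoin_none_some _)]

lemma corona_reach_root (hG : G.Connected) (i : V) (w : V ⊕ V × W) :
    (corona G H).Reachable (.inl i) w := by
  have key : ∀ j : V, (corona G H).Reachable (.inl i) (.inl j) := by
    intro j
    let f : G →g corona G H := ⟨Sum.inl, fun {a b} h => (corona_ll a b).2 h⟩
    exact (hG.preconnected i j).map f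
  rcases w with j | ⟨j, y⟩
  · exact key j
  · exact (key j).trans ((corona_lr j (j, y)).2 rfl).reachable

lemma walk_out (i : V) {a w : V ⊕ V × W} (p : (corona G H).Walk a w) :
    (∀ y, w ≠ .inr (i, y)) → ∀ x, a = .inr (i, x) →
      (corona G H).dist (.inl i) w + 1 ≤ p.length := by
  induction p with
  | nil => intro hw x hx; exact absurd hx (hw x)
  | @cons a b c h q ih =>
    intro hw x hx
    subst hx
    rcases b with j | ⟨j, y⟩
    · obtain rfl : j = i := (corona_rl _ _).1 h
      have := (corona G H).dist_le q
      simpa using this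
    · obtain rfl : i = j := ((corona_rr _ _).1 h).1
      have := ih hw y rfl
      simp only [Walk.length_cons]
      omega

lemma dist_out (hG : G.Connected) (i : V) (x : W) (w : V ⊕ V × W)
    (hw : ∀ y, w ≠ .inr (i, y)) :
    (corona G H).dist (.inr (i, x)) w = (corona G H).dist (.inl i) w + 1 := by
  have hadj : (corona G H).Adj (.inr (i, x)) (.inl i) := (corona_rl _ _).2 rfl
  have hr := corona_reach_root (H := H) hG i w
  apply le_antisymm
  · obtain ⟨p, hp⟩ := hr.exists_walk_length_eq_dist
    have := (corona G H).dist_le (Walk.cons hadj p)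
    simpa [hp] using this
  · obtain ⟨p, hp⟩ := (hadj.reachable.trans hr).exists_walk_length_eq_dist
    rw [← hp]
    exact walk_out i p hw x rfl

lemma dist_none (x : W) : (oneJoin H).dist (some x) none = 1 :=
  SimpleGraph.dist_eq_one_iff_adj.2 (oneJoin_none_some x).symm

lemma localMetricDim_le {U : Type*} [Fintype U] {K : SimpleGraph U} {S : Finset U}
    (hS : IsLocalMetricGenerator K ↑S) : localMetricDim K ≤ S.card :=
  Nat.sInf_le ⟨S, hS, rfl⟩

lemma exists_basis {U : Type*} [Fintype U] (K : SimpleGraph U) :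
    ∃ S : Finset U, IsLocalMetricGenerator K ↑S ∧ S.card = localMetricDim K := by
  have hne : {k | ∃ S : Finset U, IsLocalMetricGenerator K ↑S ∧ S.card = k}.Nonempty := by
    refine ⟨_, Finset.univ, ?_, rfl⟩
    intro u v h
    refine ⟨u, by simp, ?_⟩
    rw [SimpleGraph.dist_self, SimpleGraph.dist_eq_one_iff_adj.2 h.symm]
    exact zero_ne_one
  exact Nat.sInf_mem hne

end CoronaHelpers

/-- If the vertex of K₁ belongs to some local metric basis of K₁ + H (H a
non-empty graph), then dim_l(G ⊙ H) = n (dim_l(K₁ + H) - 1) for every connected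
graph G of order n ≥ 2. -/
theorem localMetricDim_corona_of_mem {V W : Type*} [Fintype V] [Fintype W]
    (G : SimpleGraph V) (H : SimpleGraph W) (hG : G.Connected)
    (hne : H.edgeSet.Nonempty) (hn : 2 ≤ Fintype.card V)
    (hv : ∃ B : Finset (Option W), IsLocalMetricBasis (oneJoin H) B ∧ none ∈ B) :
    localMetricDim (corona G H) = Fintype.card V * (localMetricDim (oneJoin H) - 1) := by
  classical
  obtain ⟨B, ⟨hB, hBc⟩, hBn⟩ := hv
  apply le_antisymm
  · -- upper bound
    have hsep : ∀ x y, H.Adj x y → ∃ b, some b ∈ B ∧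
        (oneJoin H).dist (some x) (some b) ≠ (oneJoin H).dist (some y) (some b) := by
      intro x y h
      obtain ⟨b, hb, hd⟩ := hB ((oneJoin_some_some x y).2 h)
      rcases b with _ | b
      · exact absurd (by rw [dist_none, dist_none]) hd
      · exact ⟨b, hb, hd⟩
    obtain ⟨b₀, hb₀⟩ : ∃ b, some b ∈ B := by
      obtain ⟨e, he⟩ := hne
      induction e with
      | _ x y =>
        obtain ⟨b, hb, _⟩ := hsep x y he
        exact ⟨b, hb⟩
    let S : Finset (V ⊕ V × W) :=
      ((Finset.univ : Finset V) ×ˢ (Finset.eraseNone B)).map Function.Embedding.inr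
    have hmem : ∀ i b, some b ∈ B → (Sum.inr (i, b) : V ⊕ V × W) ∈ (S : Set (V ⊕ V × W)) := by
      intro i b hb
      simp [S, hb]
    have hcard : S.card = Fintype.card V * (localMetricDim (oneJoin H) - 1) := by
      have : (Finset.eraseNone B).card = B.card - 1 := by
        rw [Finset.card_eraseNone_of_mem hBn]
      simp only [S, Finset.card_map, Finset.card_product, Finset.card_univ, this, hBc]
    have hroot : ∀ (i : V) (x : W), ∃ w ∈ (S : Set (V ⊕ V × W)),
        (corona G H).dist (.inl i) w ≠ (corona G H).dist (.inr (i, x)) w := by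
      intro i x
      have : Nontrivial V := Fintype.one_lt_card_iff_nontrivial.1 hn
      obtain ⟨j, hj⟩ := exists_ne i
      refine ⟨_, hmem j b₀ hb₀, ?_⟩
      rw [dist_out hG i x (.inr (j, b₀)) (by
        intro y h
        simp only [Sum.inr.injEq, Prod.mk.injEq] at h
        exact hj h.1)]
      omega
    rw [← hcard]
    apply localMetricDim_le
    rintro (i | ⟨i, x⟩) (j | ⟨j, y⟩) h
    · refine ⟨_, hmem i b₀ hb₀, ?_⟩
      rw [SimpleGraph.dist_eq_one_iff_adj.2 ((corona_lr i (i, b₀)).2 rfl)]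
      intro h1
      have h2 := (corona_lr _ _).1 (SimpleGraph.dist_eq_one_iff_adj.1 h1.symm)
      exact ((corona_ll _ _).1 h).ne h2.symm
    · obtain rfl : i = j := (corona_lr _ _).1 h
      exact hroot i y
    · obtain rfl : j = i := (corona_rl _ _).1 h
      obtain ⟨w, hw, hd⟩ := hroot j x
      exact ⟨w, hw, hd.symm⟩
    · obtain ⟨h1, h2⟩ := (corona_rr _ _).1 h
      obtain rfl : i = j := h1
      obtain ⟨b, hb, hd⟩ := hsep x y h2
      refine ⟨_, hmem i b hb, ?_⟩
      rw [dist_copy, dist_copy]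
      exact hd
  · -- lower bound
    obtain ⟨S, hS, hSc⟩ := exists_basis (corona G H)
    rw [← hSc]
    let T : V → Finset W := fun i => Finset.univ.filter fun x => Sum.inr (i, x) ∈ S
    have hT : ∀ i, localMetricDim (oneJoin H) - 1 ≤ (T i).card := by
      intro i
      have hgen : IsLocalMetricGenerator (oneJoin H) ↑(Finset.insertNone (T i)) := by
        rintro (_ | x) (_ | y) h
        · exact absurd rfl h.ne
        · refine ⟨none, by simp, ?_⟩
          rw [dist_none, SimpleGraph.dist_self]
          exact zero_ne_one
        · refine ⟨none, by simp, ?_⟩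
          rw [dist_none, SimpleGraph.dist_self]
          exact one_ne_zero
        · have h' := (oneJoin_some_some x y).1 h
          obtain ⟨w, hw, hd⟩ := hS ((corona_rr (G := G) (i, x) (i, y)).2 ⟨rfl, h'⟩)
          by_cases hc : ∀ z, w ≠ .inr (i, z)
          · rw [dist_out hG i x w hc, dist_out hG i y w hc] at hd
            exact absurd rfl hd
          · push Not at hc
            obtain ⟨z, rfl⟩ := hc
            rw [dist_copy, dist_copy] at hd
            refine ⟨some z, ?_, hd⟩
            have hw' : (Sum.inr (i, z) : V ⊕ V × W) ∈ S := hw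
            simp [T, hw']
      have := localMetricDim_le hgen
      rw [Finset.card_insertNone] at this
      omega
    calc Fintype.card V * (localMetricDim (oneJoin H) - 1)
        = ∑ _i : V, (localMetricDim (oneJoin H) - 1) := by simp
      _ ≤ ∑ i : V, (T i).card := Finset.sum_le_sum fun i _ => hT i
      _ = ((Finset.univ.sigma T).map
            ⟨fun p => (Sum.inr (p.1, p.2) : V ⊕ V × W), by
              rintro ⟨a, b⟩ ⟨c, d⟩ h
              simp only [Sum.inr.injEq, Prod.mk.injEq] at h
              obtain ⟨rfl, rfl⟩ := h
              rfl⟩).card := by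
          rw [Finset.card_map, Finset.card_sigma]
      _ ≤ S.card := by
          apply Finset.card_le_card
          intro w hw
          simp only [Finset.mem_map, Finset.mem_sigma, Finset.mem_univ, true_and] at hw
          obtain ⟨⟨i, x⟩, hx, rfl⟩ := hw
          exact (Finset.mem_filter.1 hx).2
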